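/- arXiv:2112.05105 — 4 statements merged into one kernel-verified Lean document; each statement's English description precedes it below -/
import Mathlib

section
/- Let (X,d) be a compact metric space and ν a finite Borel measure on X. Let t > 0 and δ > 0, and let (f_j)_{j≥1} be a sequence of nonnegative Borel functions on X such that ∑_{j=1}^∞ ∫_X f_j dν < ∞. Define B(δ) = { x ∈ X : limsup_{j→∞} ∫_X f_j(y)·d(x,y)^{-t} dν(y) ≥ δ }. Then the Hausdorff dimension of B(δ) (with respect to the metric d) is at most t. -/
open MeasureTheory Metric ENNReal Filter

/-- If `μ (closedBall x r) ≤ c * r ^ s` at all scales and `t < s`, then the `t`-potential of `μ`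
at `x` is at most a constant times `c`, the constant depending on `X`, `s` and `t` only. -/
theorem exists_potential_le_of_measure_closedBall_le (X : Type*) [PseudoMetricSpace X]
    [CompactSpace X] [MeasurableSpace X] [BorelSpace X] {s t : ℝ} (ht : 0 < t) (hts : t < s) :
    ∃ K : ℝ≥0∞, K ≠ 0 ∧ K ≠ ∞ ∧ ∀ (μ : Measure X) (x : X) (c : ℝ≥0∞),
      (∀ r : ℝ, 0 < r → μ (closedBall x r) ≤ c * ENNReal.ofReal r ^ s) →
      ∫⁻ y, ENNReal.ofReal (dist x y) ^ (-t) ∂μ ≤ K * c := by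
  obtain ⟨R, hR, hdist⟩ : ∃ R : ℝ, 0 < R ∧ ∀ x y : X, dist x y ≤ R := by
    refine ⟨diam (Set.univ : Set X) + 1, by positivity, fun x y => ?_⟩
    have := dist_le_diam_of_mem (isCompact_univ (X := X)).isBounded (Set.mem_univ x)
      (Set.mem_univ y)
    linarith
  have hst : 0 < s - t := sub_pos.2 hts
  set q : ℝ := (1 / 2) ^ (s - t) with hq
  have hq0 : 0 < q := by positivity
  have hq1 : q < 1 := Real.rpow_lt_one (by norm_num) (by norm_num) hst
  set A : ℝ := 2 ^ t * R ^ (s - t) with hA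
  have hA0 : 0 < A := by positivity
  refine ⟨ENNReal.ofReal (A * (1 - q)⁻¹), ?_, ENNReal.ofReal_ne_top, fun μ x c h => ?_⟩
  · rw [Ne, ENNReal.ofReal_eq_zero, not_le]
    have := sub_pos.2 hq1
    positivity
  let ρ : ℕ → ℝ := fun k => R * (1 / 2) ^ k
  have hρ : ∀ k, 0 < ρ k := fun k => by positivity
  let a : ℕ → ℝ := fun k => (ρ k / 2) ^ (-t)
  have hpt : ∀ y, ENNReal.ofReal (dist x y) ^ (-t) ≤
      ∑' k, (closedBall x (ρ k)).indicator (fun _ => ENNReal.ofReal (a k)) y := by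
    intro y
    rcases (dist_nonneg (x := x) (y := y)).eq_or_lt with h0 | h0
    · have hlim : Tendsto (fun k => ENNReal.ofReal (a k)) atTop (nhds ∞) := by
        refine ENNReal.tendsto_ofReal_atTop.comp ?_
        refine (tendsto_rpow_neg_nhdsGT_zero (by linarith)).comp ?_
        refine tendsto_nhdsWithin_iff.2 ⟨?_, Eventually.of_forall fun k => half_pos (hρ k)⟩
        have := ((tendsto_pow_atTop_nhds_zero_of_lt_one (r := (1 / 2 : ℝ)) (by norm_num)
          (by norm_num)).const_mul R).div_const 2
        simpa [ρ] using this
      refine le_top.trans (le_of_tendsto' hlim fun k => ?_)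
      refine le_trans ?_ (ENNReal.le_tsum k)
      rw [Set.indicator_of_mem]
      rw [mem_closedBall, dist_comm, ← h0]
      exact (hρ k).le
    · obtain ⟨k, hk1, hk2⟩ := exists_nat_pow_near_of_lt_one (div_pos h0 hR)
        ((div_le_one hR).2 (hdist x y)) (y := (1 / 2 : ℝ)) (by norm_num) (by norm_num)
      refine le_trans ?_ (ENNReal.le_tsum k)
      rw [lt_div_iff₀ hR] at hk1
      rw [div_le_iff₀ hR] at hk2
      rw [Set.indicator_of_mem (by rw [mem_closedBall, dist_comm]; simp only [ρ]; linarith),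
        ENNReal.ofReal_rpow_of_pos h0]
      refine ENNReal.ofReal_le_ofReal <|
        Real.rpow_le_rpow_of_nonpos (half_pos (hρ k)) ?_ (by linarith)
      simp only [ρ]
      rw [pow_succ] at hk1
      linarith
  calc ∫⁻ y, ENNReal.ofReal (dist x y) ^ (-t) ∂μ
      ≤ ∫⁻ y, ∑' k, (closedBall x (ρ k)).indicator (fun _ => ENNReal.ofReal (a k)) y ∂μ :=
        lintegral_mono hpt
    _ = ∑' k, ENNReal.ofReal (a k) * μ (closedBall x (ρ k)) := by
        rw [lintegral_tsum fun k =>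
          (measurable_const.indicator isClosed_closedBall.measurableSet).aemeasurable]
        simp_rw [lintegral_indicator_const isClosed_closedBall.measurableSet]
    _ ≤ ∑' k, ENNReal.ofReal (A * q ^ k) * c := by
        refine ENNReal.tsum_le_tsum fun k => ?_
        refine (mul_le_mul_right (h _ (hρ k)) _).trans_eq ?_
        rw [ENNReal.ofReal_rpow_of_pos (hρ k), mul_left_comm,
          ← ENNReal.ofReal_mul (by positivity), mul_comm c]
        congr 2
        simp only [a]
        rw [Real.div_rpow (hρ k).le zero_le_two, div_mul_eq_mul_div, ← Real.rpow_add (hρ k),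
          neg_add_eq_sub, Real.rpow_neg zero_le_two, div_inv_eq_mul,
          Real.mul_rpow hR.le (by positivity), hq, ← Real.rpow_natCast, ← Real.rpow_natCast,
          ← Real.rpow_mul (by norm_num), ← Real.rpow_mul (by norm_num), mul_comm (k : ℝ)]
        ring
    _ = ENNReal.ofReal (A * (1 - q)⁻¹) * c := by
        rw [ENNReal.tsum_mul_right, ← tsum_geometric_of_lt_one hq0.le hq1, ← tsum_mul_left,
          ENNReal.ofReal_tsum_of_nonneg (fun k => by positivity)
            ((summable_geometric_of_lt_one hq0.le hq1).mul_left A)]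

/-- **Vitali bound for Hausdorff premeasures**: if every point of `E` is the centre of a small ball
of measure at least `c * r ^ s`, then the premeasure of `E` is controlled by the total mass. -/
theorem hausdorff_pre_le_of_le_measure_closedBall {X : Type*} [MetricSpace X]
    [TopologicalSpace.SeparableSpace X] [MeasurableSpace X] [BorelSpace X] (μ : Measure X)
    {s : ℝ} (hs : 0 ≤ s) {c ε : ℝ≥0∞} (hc0 : c ≠ 0) (hc : c ≠ ∞) (hε : ε ≠ ∞) {E : Set X}
    (hE : ∀ x ∈ E, ∃ r : ℝ, 0 < r ∧ ENNReal.ofReal (10 * r) ≤ ε ∧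
      c * ENNReal.ofReal r ^ s ≤ μ (closedBall x r)) :
    OuterMeasure.mkMetric'.pre (fun S => ediam S ^ s) ε E ≤ 10 ^ s * c⁻¹ * μ Set.univ := by
  choose! r hr0 hrε hr using hE
  have hbound : ∀ x ∈ E, r x ≤ ε.toReal := fun x hx => by
    have := (ENNReal.ofReal_le_iff_le_toReal hε).1 (hrε x hx)
    linarith [hr0 x hx]
  obtain ⟨u, huE, hdisj, hcov⟩ := Vitali.exists_disjoint_subfamily_covering_enlargement_closedBall
    E id r _ hbound 5 (by norm_num)
  simp only [id] at hdisj hcov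
  have hu : u.Countable := hdisj.countable_of_nonempty_interior fun x hx =>
    ⟨x, ball_subset_interior_closedBall (mem_ball_self (hr0 x (huE hx)))⟩
  have hEu : E ⊆ ⋃ x ∈ u, closedBall x (5 * r x) := fun x hx => by
    obtain ⟨y, hy, hxy⟩ := hcov x hx
    exact Set.mem_biUnion hy (hxy (mem_closedBall_self (hr0 x hx).le))
  have hdiam : ∀ x ∈ u, ediam (closedBall x (5 * r x)) ≤ ENNReal.ofReal (10 * r x) := by
    intro x hx
    refine ediam_le fun y hy z hz => ?_
    rw [edist_dist]
    refine ENNReal.ofReal_le_ofReal ?_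
    have := dist_triangle_right y z x
    rw [mem_closedBall] at hy hz
    linarith
  calc OuterMeasure.mkMetric'.pre (fun S => ediam S ^ s) ε E
      ≤ OuterMeasure.mkMetric'.pre (fun S => ediam S ^ s) ε (⋃ x ∈ u, closedBall x (5 * r x)) :=
        measure_mono hEu
    _ ≤ ∑' x : u, OuterMeasure.mkMetric'.pre (fun S => ediam S ^ s) ε
          (closedBall (x : X) (5 * r x)) := measure_biUnion_le _ hu _
    _ ≤ ∑' x : u, 10 ^ s * c⁻¹ * μ (closedBall (x : X) (r x)) := by
        refine ENNReal.tsum_le_tsum fun x => ?_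
        have hx := huE x.2
        refine (OuterMeasure.mkMetric'.pre_le ((hdiam x x.2).trans (hrε x hx))).trans ?_
        calc ediam (closedBall (x : X) (5 * r x)) ^ s
            ≤ ENNReal.ofReal (10 * r x) ^ s := ENNReal.rpow_le_rpow (hdiam x x.2) hs
          _ = 10 ^ s * c⁻¹ * (c * ENNReal.ofReal (r x) ^ s) := by
              rw [ENNReal.ofReal_mul (by norm_num), ENNReal.mul_rpow_of_nonneg _ _ hs, mul_assoc,
                ← mul_assoc c⁻¹, ENNReal.inv_mul_cancel hc0 hc, one_mul, ENNReal.ofReal_ofNat]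
          _ ≤ _ := mul_le_mul_right (hr x hx) _
    _ = 10 ^ s * c⁻¹ * ∑' x : u, μ (closedBall (x : X) (r x)) := ENNReal.tsum_mul_left
    _ = 10 ^ s * c⁻¹ * μ (⋃ x ∈ u, closedBall x (r x)) := by
        rw [measure_biUnion hu hdisj fun x _ => isClosed_closedBall.measurableSet]
    _ ≤ _ := mul_le_mul_right (measure_mono (Set.subset_univ _)) _

/-- If the total masses of `μ j` are summable, the points where the `t`-potentials of `μ j` exceed
a fixed positive level infinitely often form a null set for the Hausdorff measures of dimension
larger than `t`. -/
theorem hausdorffMeasure_setOf_frequently_lt_potential_eq_zero {X : Type*} [MetricSpace X]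
    [CompactSpace X] [MeasurableSpace X] [BorelSpace X] {s t : ℝ} (ht : 0 < t) (hts : t < s)
    (μ : ℕ → Measure X) (hμ : ∑' j, μ j Set.univ ≠ ∞) {η : ℝ≥0∞} (hη0 : η ≠ 0) (hη : η ≠ ∞) :
    Measure.hausdorffMeasure s
      {x : X | ∃ᶠ j in atTop, η < ∫⁻ y, ENNReal.ofReal (dist x y) ^ (-t) ∂μ j} = 0 := by
  obtain ⟨K, hK0, hK, hpot⟩ := exists_potential_le_of_measure_closedBall_le X ht hts
  have hs : 0 < s := ht.trans hts
  set c : ℝ≥0∞ := η / K with hc_def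
  have hc0 : c ≠ 0 := (ENNReal.div_pos hη0 hK).ne'
  have hc : c ≠ ∞ := ENNReal.div_ne_top hη hK0
  rw [Measure.hausdorffMeasure, ← OuterMeasure.coe_mkMetric, OuterMeasure.mkMetric,
    OuterMeasure.mkMetric'.eq_iSup_nat, OuterMeasure.iSup_apply, ENNReal.iSup_eq_zero]
  refine fun n => ?_
  obtain ⟨ε, hε0, hε, hεn⟩ : ∃ ε : ℝ≥0∞, ε ≠ 0 ∧ ε ≠ ∞ ∧ ε ≤ (n : ℝ≥0∞)⁻¹ :=
    ⟨(n + 1 : ℝ≥0∞)⁻¹, ENNReal.inv_ne_zero.2 (by finiteness), by simp,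
      ENNReal.inv_le_inv.2 le_self_add⟩
  refine le_antisymm ((OuterMeasure.mkMetric'.mono_pre _ hεn _).trans ?_) zero_le
  have hsmall : ∀ᶠ j in atTop, μ j Set.univ < c * (ε / 10) ^ s := by
    refine (ENNReal.tendsto_atTop_zero_of_tsum_ne_top hμ).eventually_lt_const ?_
    exact ENNReal.mul_pos hc0 (ENNReal.rpow_pos (ENNReal.div_pos hε0 (by simp))
      (ENNReal.div_ne_top hε (by simp))).ne'
  obtain ⟨N, hN⟩ := eventually_atTop.1 hsmall
  let E : ℕ → Set X := fun j =>
    {x | N ≤ j ∧ η < ∫⁻ y, ENNReal.ofReal (dist x y) ^ (-t) ∂μ j}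
  have hE : ∀ j, OuterMeasure.mkMetric'.pre (fun S => ediam S ^ s) ε (E j) ≤
      10 ^ s * c⁻¹ * μ j Set.univ := by
    refine fun j => hausdorff_pre_le_of_le_measure_closedBall (μ j) hs.le hc0 hc hε ?_
    rintro x ⟨hj, hx⟩
    obtain ⟨r, hr0, hr⟩ : ∃ r : ℝ, 0 < r ∧ c * ENNReal.ofReal r ^ s < μ j (closedBall x r) := by
      by_contra! hcon
      refine (hx.trans_le (hpot (μ j) x c hcon)).ne ?_
      rw [hc_def, ENNReal.mul_div_cancel hK0 hK]
    refine ⟨r, hr0, ?_, hr.le⟩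
    have hlt := (hr.trans_le (measure_mono (Set.subset_univ _))).trans (hN j hj)
    have hlt' := (ENNReal.rpow_lt_rpow_iff hs).1 (lt_of_mul_lt_mul_left' hlt)
    rw [ENNReal.ofReal_mul (by norm_num), ENNReal.ofReal_ofNat, mul_comm]
    exact ENNReal.mul_le_of_le_div hlt'.le
  have hsum : ∑' j, OuterMeasure.mkMetric'.pre (fun S => ediam S ^ s) ε (E j) ≠ ∞ := by
    refine ne_top_of_le_ne_top ?_ (ENNReal.tsum_le_tsum hE)
    rw [ENNReal.tsum_mul_left]
    have := ENNReal.inv_ne_top.2 hc0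
    exact ENNReal.mul_ne_top (ENNReal.mul_ne_top (by finiteness) this) hμ
  refine (measure_mono fun x hx => ?_).trans (measure_setOfPred_frequently_eq_zero hsum).le
  exact (hx.and_eventually (eventually_ge_atTop N)).mono fun j hj => ⟨hj.2, hj.1⟩

/-- Let `(X,d)` be a compact metric space and `ν` a finite Borel measure on
`X`. Let `t > 0`, `δ > 0`, and let `(f_j)` be nonnegative Borel functions with
`∑_j ∫ f_j dν < ∞`. Then the set
`B(δ) = {x : limsup_j ∫ f_j(y) d(x,y)^{-t} dν(y) ≥ δ}` has Hausdorff dimension at most `t`. -/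
theorem hausdorff_dim_of_divergent_potentials
    {X : Type*} [MetricSpace X] [CompactSpace X] [MeasurableSpace X] [BorelSpace X]
    (ν : Measure X) [IsFiniteMeasure ν]
    (t δ : ℝ) (ht : 0 < t) (hδ : 0 < δ)
    (f : ℕ → X → ℝ≥0∞) (hf : ∀ j, Measurable (f j))
    (hsum : ∑' j : ℕ, ∫⁻ y, f j y ∂ν < ⊤) :
    dimH {x : X | ENNReal.ofReal δ ≤
        limsup (fun j : ℕ => ∫⁻ y, f j y * (ENNReal.ofReal (dist x y)) ^ (-t) ∂ν) atTop}
      ≤ ENNReal.ofReal t := by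
  by_contra! hlt
  obtain ⟨s, hts, hsd⟩ := ENNReal.lt_iff_exists_nnreal_btwn.1 hlt
  have hts' : t < s := by
    rwa [← ENNReal.ofReal_coe_nnreal, ENNReal.ofReal_lt_ofReal_iff_of_nonneg ht.le] at hts
  have hpot : ∀ (j : ℕ) (x : X),
      ∫⁻ y, ENNReal.ofReal (dist x y) ^ (-t) ∂ν.withDensity (f j) =
        ∫⁻ y, f j y * ENNReal.ofReal (dist x y) ^ (-t) ∂ν := fun j x => by
    rw [lintegral_withDensity_eq_lintegral_mul _ (hf j) (by fun_prop)]
    rfl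
  have hδ' : ENNReal.ofReal (δ / 2) < ENNReal.ofReal δ :=
    (ENNReal.ofReal_lt_ofReal_iff hδ).2 (half_lt_self hδ)
  have hzero := hausdorffMeasure_setOf_frequently_lt_potential_eq_zero ht hts'
    (fun j => ν.withDensity (f j)) (by simpa using hsum.ne)
    (ENNReal.ofReal_pos.2 (half_pos hδ)).ne' ENNReal.ofReal_ne_top
  simp_rw [hpot] at hzero
  refine absurd (measure_mono_null (fun x hx => ?_) hzero)
    ((hausdorffMeasure_of_lt_dimH hsd).trans_ne ENNReal.top_ne_zero)
  exact frequently_lt_of_lt_limsup (by isBoundedDefault) (hδ'.trans_le hx)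
end

section
/- Let (X,d) be a compact metric space and let ν be a finite Borel measure on X that is upper m-Ahlfors regular with constant A, where A > 0 and m > 1. Let 1 ≤ p ≤ m and δ > 0, and let (f_j)_{j≥1} be a sequence of nonnegative Borel functions on X such that ∑_{j=1}^∞ ∫_X f_j^p dν < ∞. Define B(δ) = { x ∈ X : limsup_{j→∞} ∫_X f_j(y)·d(x,y)^{1−m} dν(y) ≥ δ }. Then the Hausdorff dimension of B(δ) (with respect to the metric d) is at most m − p. -/
open MeasureTheory Metric ENNReal Filter

/-- Vitali covering estimate: a set each of whose points is the centre of a ball of large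
`μ`-mass compared with the `s`-th power of its radius has small `s`-dimensional content. -/
theorem exists_countable_cover_tsum_ediam_rpow_le {X : Type*} [MetricSpace X]
    [TopologicalSpace.SeparableSpace X] [MeasurableSpace X] [BorelSpace X]
    (μ : Measure X) [IsFiniteMeasure μ] {s c : ℝ} (hs : 0 < s) (hc : 0 < c) {B : Set X}
    (h : ∀ x ∈ B, ∃ r, 0 < r ∧ ENNReal.ofReal (c * r ^ s) ≤ μ (closedBall x r)) :
    ∃ (u : Set X) (t : u → Set X), u.Countable ∧ B ⊆ ⋃ i, t i ∧
      ∑' i, ediam (t i) ^ s ≤ ENNReal.ofReal (10 ^ s / c) * μ Set.univ := by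
  choose! r hr0 hr using h
  have hbound : ∀ x ∈ B, r x ≤ ((μ Set.univ).toReal / c) ^ (1 / s) := by
    intro x hx
    have h1 : c * r x ^ s ≤ (μ Set.univ).toReal := by
      rw [← ENNReal.ofReal_le_iff_le_toReal (measure_ne_top _ _)]
      exact (hr x hx).trans (measure_mono (Set.subset_univ _))
    calc r x = (r x ^ s) ^ (1 / s) := by
          rw [one_div, Real.rpow_rpow_inv (hr0 x hx).le hs.ne']
      _ ≤ _ := by
          refine Real.rpow_le_rpow (Real.rpow_nonneg (hr0 x hx).le _) ?_ (by positivity)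
          rw [le_div_iff₀ hc]
          linarith
  obtain ⟨u, huB, hdisj, hcov⟩ := Vitali.exists_disjoint_subfamily_covering_enlargement_closedBall
    B id r _ hbound 5 (by norm_num)
  simp only [id] at hdisj hcov
  have hu : u.Countable := hdisj.countable_of_nonempty_interior fun x hx =>
    ⟨x, interior_mono ball_subset_closedBall
      (by rw [isOpen_ball.interior_eq]; exact mem_ball_self (hr0 x (huB hx)))⟩
  refine ⟨u, fun x => closedBall x (5 * r x), hu, ?_, ?_⟩
  · intro x hx
    obtain ⟨b, hb, hxb⟩ := hcov x hx
    exact Set.mem_iUnion.2 ⟨⟨b, hb⟩, hxb (mem_closedBall_self (hr0 x hx).le)⟩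
  · have key : ∀ x : u, ediam (closedBall (x : X) (5 * r x)) ^ s ≤
        ENNReal.ofReal (10 ^ s / c) * μ (closedBall (x : X) (r x)) := by
      intro x
      have hx := huB x.2
      have h0 := hr0 x hx
      calc ediam (closedBall (x : X) (5 * r x)) ^ s ≤ ENNReal.ofReal (10 * r x) ^ s := by
            gcongr
            rw [← Metric.closedEBall_ofReal (by positivity)]
            refine ediam_closedEBall_le.trans_eq ?_
            rw [← ENNReal.ofReal_ofNat 2, ← ENNReal.ofReal_mul (by norm_num)]
            ring_nf
        _ = ENNReal.ofReal (10 ^ s / c) * ENNReal.ofReal (c * r x ^ s) := by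
            rw [ENNReal.ofReal_rpow_of_pos (by positivity), ← ENNReal.ofReal_mul (by positivity),
              Real.mul_rpow (by norm_num) h0.le]
            congr 1
            field_simp
        _ ≤ _ := by gcongr; exact hr x hx
    have : Countable u := hu.to_subtype
    calc _ ≤ ∑' x : u, ENNReal.ofReal (10 ^ s / c) * μ (closedBall (x : X) (r x)) :=
          ENNReal.tsum_le_tsum key
      _ = ENNReal.ofReal (10 ^ s / c) * μ (⋃ x : u, closedBall (x : X) (r x)) := by
          rw [ENNReal.tsum_mul_left, measure_iUnion]
          · intro x y hxy
            exact hdisj x.2 y.2 (fun h => hxy (Subtype.ext h))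
          · exact fun x => measurableSet_closedBall
      _ ≤ _ := by gcongr; exact Set.subset_univ _

theorem hausdorffMeasure_eq_zero_of_forall_exists_le_measure_closedBall {X : Type*} [MetricSpace X]
    [TopologicalSpace.SeparableSpace X] [MeasurableSpace X] [BorelSpace X]
    (μ : ℕ → Measure X) [∀ n, IsFiniteMeasure (μ n)]
    (hμ : Tendsto (fun n => μ n Set.univ) atTop (nhds 0))
    {s c : ℝ} (hs : 0 < s) (hc : 0 < c) {B : Set X}
    (h : ∀ n, ∀ x ∈ B, ∃ r, 0 < r ∧ ENNReal.ofReal (c * r ^ s) ≤ μ n (closedBall x r)) :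
    Measure.hausdorffMeasure s B = 0 := by
  choose u t hu hB ht using fun n =>
    exists_countable_cover_tsum_ediam_rpow_le (μ n) hs hc (h n)
  have : ∀ n, Countable (u n) := fun n => (hu n).to_subtype
  have hlim : Tendsto (fun n => ENNReal.ofReal (10 ^ s / c) * μ n Set.univ) atTop (nhds 0) := by
    simpa using ENNReal.Tendsto.const_mul hμ (Or.inr ENNReal.ofReal_ne_top)
  have hlim' : Tendsto (fun n => (ENNReal.ofReal (10 ^ s / c) * μ n Set.univ) ^ (1 / s)) atTop
      (nhds 0) := by
    have := (ENNReal.continuous_rpow_const (y := 1 / s)).tendsto 0 |>.comp hlim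
    rwa [ENNReal.zero_rpow_of_pos (by positivity)] at this
  refine le_antisymm ?_ bot_le
  calc Measure.hausdorffMeasure s B ≤ liminf (fun n => ∑' i, ediam (t n i) ^ s) atTop := by
        refine Measure.hausdorffMeasure_le_liminf_tsum s B _ hlim' t ?_ (Eventually.of_forall hB)
        refine Eventually.of_forall fun n i => ?_
        rw [one_div, ENNReal.le_rpow_inv_iff hs]
        exact (ENNReal.le_tsum i).trans (ht n)
    _ ≤ liminf (fun n => ENNReal.ofReal (10 ^ s / c) * μ n Set.univ) atTop :=
        liminf_le_liminf (Eventually.of_forall ht)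
    _ = 0 := hlim.liminf_eq

/-- Hölder's inequality on a set. -/
theorem setLIntegral_le_rpow_mul_measure_rpow {X : Type*} [MeasurableSpace X] (ν : Measure X)
    {p : ℝ} (hp : 1 ≤ p) {g : X → ℝ≥0∞} (hg : Measurable g) (S : Set X) :
    ∫⁻ y in S, g y ∂ν ≤ (∫⁻ y in S, g y ^ p ∂ν) ^ (1 / p) * ν S ^ (1 - 1 / p) := by
  have := eLpNorm'_le_eLpNorm'_mul_rpow_measure_univ (μ := ν.restrict S) one_pos hp
    hg.aestronglyMeasurable
  simpa [eLpNorm'_eq_lintegral_enorm] using this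

/-- Dyadic annulus estimate for the Riesz-type potential of `g`. -/
theorem lintegral_mul_dist_rpow_le_tsum {X : Type*} [MetricSpace X]
    [MeasurableSpace X] [BorelSpace X] (ν : Measure X) [NullSingletonClass ν] (g : X → ℝ≥0∞)
    {a R : ℝ} (ha : a ≤ 0) (hR : 0 < R) (x : X) (hx : ∀ y, dist x y ≤ R) :
    ∫⁻ y, g y * ENNReal.ofReal (dist x y) ^ a ∂ν ≤
      ∑' k : ℕ, ENNReal.ofReal ((R * (1 / 2) ^ (k + 1)) ^ a) *
        ∫⁻ y in closedBall x (R * (1 / 2) ^ k), g y ∂ν := by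
  set E : ℕ → Set X := fun k =>
    closedBall x (R * (1 / 2) ^ k) \ closedBall x (R * (1 / 2) ^ (k + 1))
  have hcover : ({x}ᶜ : Set X) ⊆ ⋃ k, E k := by
    intro y hy
    have hd : 0 < dist x y := dist_pos.2 (Ne.symm hy)
    obtain ⟨k, hk1, hk2⟩ := exists_nat_pow_near_of_lt_one (div_pos hd hR)
      ((div_le_one hR).2 (hx y)) (by norm_num : (0 : ℝ) < 1 / 2) (by norm_num)
    rw [lt_div_iff₀ hR] at hk1
    rw [div_le_iff₀ hR] at hk2
    refine Set.mem_iUnion.2 ⟨k, ?_, ?_⟩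
    · rw [mem_closedBall']
      linarith
    · rw [mem_closedBall', not_le]
      linarith
  have hae : (⋃ k, E k) =ᵐ[ν] (Set.univ : Set X) := by
    rw [ae_eq_univ]
    exact measure_mono_null (Set.compl_subset_comm.1 hcover) (measure_singleton x)
  rw [← setLIntegral_univ, ← setLIntegral_congr hae]
  refine (lintegral_iUnion_le _ _).trans (ENNReal.tsum_le_tsum fun k => ?_)
  have hpos : 0 < R * (1 / 2) ^ (k + 1) := by positivity
  calc ∫⁻ y in E k, g y * ENNReal.ofReal (dist x y) ^ a ∂ν
      ≤ ∫⁻ y in E k, ENNReal.ofReal ((R * (1 / 2) ^ (k + 1)) ^ a) * g y ∂ν := by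
        refine setLIntegral_mono' (measurableSet_closedBall.diff measurableSet_closedBall) ?_
        intro y hy
        have hy' : R * (1 / 2) ^ (k + 1) < dist x y := by
          have := hy.2
          rwa [mem_closedBall', not_le] at this
        rw [mul_comm, ENNReal.ofReal_rpow_of_pos (hpos.trans hy')]
        gcongr ENNReal.ofReal ?_ * _
        exact Real.rpow_le_rpow_of_nonpos hpos hy'.le ha
    _ = ENNReal.ofReal ((R * (1 / 2) ^ (k + 1)) ^ a) * ∫⁻ y in E k, g y ∂ν :=
        lintegral_const_mul' _ _ ENNReal.ofReal_ne_top
    _ ≤ _ := by gcongr; exact Set.sdiff_subset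

/-- If the integral of `g ^ p` over balls centred at `x` is at most `c * r ^ s` with `s > m - p`
and `c` small, then the potential of `g` at `x` is small. -/
theorem exists_pos_forall_lintegral_mul_dist_rpow_le {X : Type*} [MetricSpace X]
    [MeasurableSpace X] [BorelSpace X] (ν : Measure X) [NullSingletonClass ν]
    {A m p s ε R : ℝ} (hA : 0 < A) (hm : 1 < m)
    (hreg : ∀ (x : X) (r : ℝ), 0 < r → ν (ball x r) ≤ ENNReal.ofReal (A * r ^ m))
    (hp : 1 ≤ p) (hs : m - p < s) (hε : 0 < ε) (hR : 0 < R) (hdist : ∀ x y : X, dist x y ≤ R) :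
    ∃ c : ℝ, 0 < c ∧ ∀ g : X → ℝ≥0∞, Measurable g → ∀ x,
      (∀ r, 0 < r → ∫⁻ y in closedBall x r, g y ^ p ∂ν ≤ ENNReal.ofReal (c * r ^ s)) →
      ∫⁻ y, g y * ENNReal.ofReal (dist x y) ^ (1 - m) ∂ν ≤ ENNReal.ofReal ε := by
  have hp0 : 0 < p := by linarith
  have hp1 : 0 ≤ 1 - 1 / p := by
    rw [sub_nonneg, div_le_one hp0]
    exact hp
  set θ : ℝ := (1 - m) + s * (1 / p) + m * (1 - 1 / p) with hθ
  have hθ0 : 0 < θ := by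
    have : θ = (s - (m - p)) / p := by
      rw [hθ]
      field_simp
      ring
    rw [this]
    exact div_pos (by linarith) hp0
  set q : ℝ := (1 / 2) ^ θ with hq
  have hq0 : 0 < q := by positivity
  have hq1 : q < 1 := Real.rpow_lt_one (by norm_num) (by norm_num) hθ0
  set M : ℝ := (R * (1 / 2)) ^ (1 - m) * (R ^ s) ^ (1 / p) * (A * (2 * R) ^ m) ^ (1 - 1 / p) with hM
  have hM0 : 0 < M := by positivity
  have h1q : 0 < 1 - q := by linarith
  set c : ℝ := (ε * (1 - q) / M) ^ p with hc
  have hcp : c ^ (1 / p) = ε * (1 - q) / M := by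
    rw [hc, one_div, Real.rpow_rpow_inv (by positivity) hp0.ne']
  have hc0 : 0 < c := by positivity
  refine ⟨c, hc0, fun g hg x hx => ?_⟩
  have hterm : ∀ k : ℕ, ENNReal.ofReal ((R * (1 / 2) ^ (k + 1)) ^ (1 - m)) *
      ∫⁻ y in closedBall x (R * (1 / 2) ^ k), g y ∂ν ≤
      ENNReal.ofReal (ε * (1 - q) * q ^ k) := by
    intro k
    rw [pow_succ, mul_comm ((1 / 2 : ℝ) ^ k), ← mul_assoc]
    set h : ℝ := (1 / 2) ^ k with hh
    have hh0 : 0 < h := by positivity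
    have hν : ν (closedBall x (R * h)) ≤ ENNReal.ofReal (A * (2 * R * h) ^ m) :=
      (measure_mono (closedBall_subset_ball (by nlinarith [mul_pos hR hh0]))).trans
        (hreg x (2 * R * h) (by positivity))
    calc _ ≤ ENNReal.ofReal ((R * (1 / 2) * h) ^ (1 - m)) *
          (ENNReal.ofReal (c * (R * h) ^ s) ^ (1 / p) *
            ENNReal.ofReal (A * (2 * R * h) ^ m) ^ (1 - 1 / p)) := by
          gcongr
          refine (setLIntegral_le_rpow_mul_measure_rpow ν hp hg _).trans ?_
          gcongr
          exact hx _ (by positivity)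
      _ = ENNReal.ofReal ((R * (1 / 2) * h) ^ (1 - m) * ((c * (R * h) ^ s) ^ (1 / p) *
            (A * (2 * R * h) ^ m) ^ (1 - 1 / p))) := by
          rw [ENNReal.ofReal_rpow_of_pos (by positivity), ENNReal.ofReal_rpow_of_pos (by positivity),
            ← ENNReal.ofReal_mul (by positivity), ← ENNReal.ofReal_mul (by positivity)]
      _ = ENNReal.ofReal (ε * (1 - q) * q ^ k) := by
          congr 1
          have hqk : q ^ k = h ^ (1 - m) * (h ^ s) ^ (1 / p) * (h ^ m) ^ (1 - 1 / p) := by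
            rw [← Real.rpow_mul hh0.le, ← Real.rpow_mul hh0.le, ← Real.rpow_add hh0,
              ← Real.rpow_add hh0, ← hθ, hq, hh, Real.rpow_pow_comm (by norm_num)]
          have e1 : (R * (1 / 2) * h) ^ (1 - m) = (R * (1 / 2)) ^ (1 - m) * h ^ (1 - m) :=
            Real.mul_rpow (by positivity) hh0.le
          have e2 : (c * (R * h) ^ s) ^ (1 / p) =
              c ^ (1 / p) * ((R ^ s) ^ (1 / p) * (h ^ s) ^ (1 / p)) := by
            rw [Real.mul_rpow hc0.le (by positivity), Real.mul_rpow hR.le hh0.le,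
              Real.mul_rpow (by positivity) (by positivity)]
          have e3 : (A * (2 * R * h) ^ m) ^ (1 - 1 / p) =
              (A * (2 * R) ^ m) ^ (1 - 1 / p) * (h ^ m) ^ (1 - 1 / p) := by
            rw [Real.mul_rpow (by positivity) hh0.le, ← mul_assoc,
              Real.mul_rpow (by positivity) (by positivity)]
          have e4 : ε * (1 - q) = c ^ (1 / p) * M := by
            rw [hcp, div_mul_cancel₀ _ hM0.ne']
          rw [e1, e2, e3, e4, hqk, hM]
          ring
  calc _ ≤ ∑' k : ℕ, ENNReal.ofReal (ε * (1 - q) * q ^ k) :=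
        (lintegral_mul_dist_rpow_le_tsum ν g (by linarith) hR x (hdist x)).trans
          (ENNReal.tsum_le_tsum hterm)
    _ = ENNReal.ofReal ε := by
        rw [← ENNReal.ofReal_tsum_of_nonneg (fun k => by positivity)
          ((summable_geometric_of_lt_one hq0.le hq1).mul_left _), tsum_mul_left,
          tsum_geometric_of_lt_one hq0.le hq1, mul_assoc, mul_inv_cancel₀ h1q.ne', mul_one]

theorem measure_singleton_eq_zero_of_measure_ball_le {X : Type*} [MetricSpace X]
    [MeasurableSpace X] (ν : Measure X) {A m : ℝ} (hm : 0 < m) {x : X}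
    (hreg : ∀ r : ℝ, 0 < r → ν (ball x r) ≤ ENNReal.ofReal (A * r ^ m)) : ν {x} = 0 := by
  have hlim : Tendsto (fun r : ℝ => ENNReal.ofReal (A * r ^ m)) (nhdsWithin 0 (Set.Ioi 0))
      (nhds 0) := by
    have : Continuous fun r : ℝ => ENNReal.ofReal (A * r ^ m) :=
      ENNReal.continuous_ofReal.comp (continuous_const.mul (Real.continuous_rpow_const hm.le))
    have h := (this.tendsto 0).mono_left (nhdsWithin_le_nhds (s := Set.Ioi 0))
    simpa [Real.zero_rpow hm.ne'] using h
  refine le_antisymm (ge_of_tendsto hlim ?_) bot_le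
  filter_upwards [self_mem_nhdsWithin] with r hr
  exact (measure_mono (Set.singleton_subset_iff.2 (mem_ball_self hr))).trans (hreg r hr)

/-- Let `(X,d)` be a compact metric space and `ν` a finite Borel measure
which is upper `m`-Ahlfors regular with constant `A`, where `m > 1`. Let `1 ≤ p ≤ m`, `δ > 0`,
and let `(f_j)` be nonnegative Borel functions with `∑_j ∫ f_j^p dν < ∞`. Then the set
`B(δ) = {x : limsup_j ∫ f_j(y) d(x,y)^{1-m} dν(y) ≥ δ}` has Hausdorff dimension at most
`m - p`. -/
theorem hausdorff_dim_control_of_Lp_potentials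
    {X : Type*} [MetricSpace X] [CompactSpace X] [MeasurableSpace X] [BorelSpace X]
    (ν : Measure X) [IsFiniteMeasure ν]
    (A m p δ : ℝ) (hA : 0 < A) (hm : 1 < m)
    (hreg : ∀ (x : X) (r : ℝ), 0 < r → ν (Metric.ball x r) ≤ ENNReal.ofReal (A * r ^ m))
    (hp1 : 1 ≤ p) (hpm : p ≤ m) (hδ : 0 < δ)
    (f : ℕ → X → ℝ≥0∞) (hf : ∀ j, Measurable (f j))
    (hsum : ∑' j : ℕ, ∫⁻ y, (f j y) ^ p ∂ν < ⊤) :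
    dimH {x : X | ENNReal.ofReal δ ≤
        limsup (fun j : ℕ => ∫⁻ y, f j y * (ENNReal.ofReal (dist x y)) ^ (1 - m) ∂ν) atTop}
      ≤ ENNReal.ofReal (m - p) := by
  have : NullSingletonClass ν :=
    ⟨fun x => measure_singleton_eq_zero_of_measure_ball_le ν (by linarith) (hreg x)⟩
  refine dimH_le fun s hs => ?_
  by_contra! hlt
  have hlt' : m - p < s := by
    have := (ENNReal.ofReal_lt_iff_lt_toReal (by linarith) ENNReal.coe_ne_top).1 hlt
    simpa using this
  obtain ⟨c, hc, hpot⟩ := exists_pos_forall_lintegral_mul_dist_rpow_le ν (ε := δ / 2)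
    (R := diam (Set.univ : Set X) + 1) hA hm hreg hp1 hlt' (by positivity)
    (by linarith [diam_nonneg (s := (Set.univ : Set X))])
    (fun x y => (dist_le_diam_of_mem isCompact_univ.isBounded (Set.mem_univ x)
      (Set.mem_univ y)).trans (by linarith))
  have hfp : ∀ j, Measurable fun y => f j y ^ p := fun j => (hf j).pow_const p
  set μ : ℕ → Measure X := fun n => ν.withDensity fun y => ∑' k, f (k + n) y ^ p with hμ
  have hμuniv : ∀ n, μ n Set.univ = ∑' k, ∫⁻ y, f (k + n) y ^ p ∂ν := by
    intro n
    rw [hμ, withDensity_apply _ MeasurableSet.univ, setLIntegral_univ,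
      lintegral_tsum fun k => (hfp (k + n)).aemeasurable]
  have : ∀ n, IsFiniteMeasure (μ n) := fun n => ⟨by
    rw [hμuniv]
    exact (ENNReal.tsum_comp_le_tsum_of_injective (add_left_injective n)
      fun j => ∫⁻ y, f j y ^ p ∂ν).trans_lt hsum⟩
  have hlim : Tendsto (fun n => μ n Set.univ) atTop (nhds 0) := by
    simp_rw [hμuniv]
    exact ENNReal.tendsto_sum_nat_add (fun j => ∫⁻ y, f j y ^ p ∂ν) hsum.ne
  refine ENNReal.zero_ne_top (Eq.trans (Eq.symm ?_) hs)
  refine hausdorffMeasure_eq_zero_of_forall_exists_le_measure_closedBall μ hlim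
    (by linarith) hc fun n x hx => ?_
  have hx' : ENNReal.ofReal (δ / 2) < limsup
      (fun j : ℕ => ∫⁻ y, f j y * (ENNReal.ofReal (dist x y)) ^ (1 - m) ∂ν) atTop :=
    lt_of_lt_of_le ((ENNReal.ofReal_lt_ofReal_iff hδ).2 (by linarith)) hx
  obtain ⟨j, hj, hjn⟩ := ((frequently_lt_of_lt_limsup isCobounded_le_of_bot hx').and_eventually
    (eventually_ge_atTop n)).exists
  by_contra! hsmall
  refine hj.not_ge (hpot (f j) (hf j) x fun r hr => le_trans ?_ (hsmall r hr).le)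
  rw [hμ, withDensity_apply _ measurableSet_closedBall]
  refine lintegral_mono fun y => ?_
  obtain ⟨k, rfl⟩ := Nat.exists_eq_add_of_le' hjn
  exact ENNReal.le_tsum (f := fun k => f (k + n) y ^ p) k
end

section
/- Let (X,d) be a compact metric space, let s > 0, and let A ⊆ X be a Borel set whose s-dimensional Hausdorff measure is positive: H^s(A) > 0. Then there exist a Borel probability measure μ on X with μ(A) = 1 and a constant c > 0 such that μ(B(x,r)) ≤ c·r^s for every x ∈ X and every r > 0 (Frostman's lemma on compact metric spaces). -/
open MeasureTheory Metric ENNReal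

open Set Filter Topology

/-- The outer measure whose value on `E` is the infimum of the total weight of the subfamilies of
`B` covering `E`. -/
noncomputable def coverContent {X J : Type*} (B : J → Set X) (w : J → ℝ≥0∞) : OuterMeasure X where
  measureOf E := ⨅ (T : Set J) (_ : E ⊆ ⋃ j ∈ T, B j), ∑' j : T, w j
  empty := le_antisymm (iInf₂_le_of_le ∅ (by simp) (by simp)) zero_le
  mono h := le_iInf₂ fun T hT => iInf₂_le T (h.trans hT)
  iUnion_nat E _ := by
    refine ENNReal.le_of_forall_pos_le_add fun ε hε hfin => ?_
    obtain ⟨δ, hδ, hδε⟩ := ENNReal.exists_pos_sum_of_countable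
      (ENNReal.coe_ne_zero.2 hε.ne') ℕ
    have hT : ∀ n, ∃ T : Set J, E n ⊆ ⋃ j ∈ T, B j ∧ ∑' j : T, w j ≤
        (⨅ (T : Set J) (_ : E n ⊆ ⋃ j ∈ T, B j), ∑' j : T, w j) + δ n := by
      intro n
      have hlt : (⨅ (T : Set J) (_ : E n ⊆ ⋃ j ∈ T, B j), ∑' j : T, w j) <
          (⨅ (T : Set J) (_ : E n ⊆ ⋃ j ∈ T, B j), ∑' j : T, w j) + δ n :=
        ENNReal.lt_add_right (ENNReal.ne_top_of_tsum_ne_top hfin.ne n)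
          (ENNReal.coe_ne_zero.2 (hδ n).ne')
      obtain ⟨T, hT⟩ := iInf_lt_iff.1 hlt
      obtain ⟨hcov, hT⟩ := iInf_lt_iff.1 hT
      exact ⟨T, hcov, hT.le⟩
    choose T hcov hcost using hT
    refine iInf₂_le_of_le (⋃ n, T n) (iUnion_subset fun n => (hcov n).trans ?_) ?_
    · exact biUnion_subset_biUnion_left (subset_iUnion T n)
    · calc ∑' j : ⋃ n, T n, w j ≤ ∑' n, ∑' j : T n, w j := ENNReal.tsum_iUnion_le_tsum w T
        _ ≤ ∑' n, ((⨅ (T : Set J) (_ : E n ⊆ ⋃ j ∈ T, B j), ∑' j : T, w j) + δ n) :=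
          ENNReal.tsum_le_tsum hcost
        _ ≤ _ := by
          rw [ENNReal.tsum_add]
          gcongr

section CoverContent

variable {X J : Type*} {B : J → Set X} {w : J → ℝ≥0∞}

theorem coverContent_le_tsum {E : Set X} {T : Set J} (h : E ⊆ ⋃ j ∈ T, B j) :
    coverContent B w E ≤ ∑' j : T, w j :=
  iInf₂_le T h

theorem coverContent_le (j : J) : coverContent B w (B j) ≤ w j := by
  simpa using coverContent_le_tsum (B := B) (w := w) (E := B j) (T := {j}) (by simp)

theorem exists_cover_of_coverContent_lt {E : Set X} {c : ℝ≥0∞} (h : coverContent B w E < c) :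
    ∃ T : Set J, E ⊆ ⋃ j ∈ T, B j ∧ ∑' j : T, w j < c := by
  obtain ⟨T, hT⟩ := iInf_lt_iff.1 h
  obtain ⟨hcov, hT⟩ := iInf_lt_iff.1 hT
  exact ⟨T, hcov, hT⟩

theorem exists_isOpen_coverContent_lt [TopologicalSpace X] (hB : ∀ j, IsOpen (B j))
    {E : Set X} {c : ℝ≥0∞} (h : coverContent B w E < c) :
    ∃ U, IsOpen U ∧ E ⊆ U ∧ coverContent B w U < c := by
  obtain ⟨T, hcov, hT⟩ := exists_cover_of_coverContent_lt h
  exact ⟨_, isOpen_biUnion fun j _ => hB j, hcov, (coverContent_le_tsum Subset.rfl).trans_lt hT⟩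

open Classical in
/-- The increasing sets lemma for the content of a countable family of open sets whose diameters
tend to zero. -/
theorem coverContent_iUnion_le_iSup [MetricSpace X] [MeasurableSpace X] [BorelSpace X]
    [Countable J] (hB : ∀ j, IsOpen (B j)) (hdiam : ∀ r > 0, {j | r < ediam (B j)}.Finite)
    (E : ℕ → Set X) (hE : Monotone E) :
    coverContent B w (⋃ n, E n) ≤ ⨆ n, coverContent B w (E n) := by
  set κ := coverContent B w
  refine le_of_forall_gt_imp_ge_of_dense fun c hc => ?_
  choose T hcov hcost using fun m =>
    exists_cover_of_coverContent_lt ((le_iSup (fun n => κ (E n)) m).trans_lt hc)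
  let 𝒰 := hyperfilter ℕ
  let S : Set J := {j | ∀ᶠ m in 𝒰, j ∈ T m}
  let U : Set X := ⋃ j ∈ S, B j
  have hagree : ∀ (F : Finset J) (n : ℕ), ∃ m, n ≤ m ∧ ∀ j ∈ F, (j ∈ T m ↔ j ∈ S) := by
    intro F n
    have h1 : ∀ᶠ m in (𝒰 : Filter ℕ), n ≤ m :=
      (Nat.hyperfilter_le_atTop) (eventually_ge_atTop n)
    have h2 : ∀ᶠ m in (𝒰 : Filter ℕ), ∀ j ∈ F, (j ∈ T m ↔ j ∈ S) := by
      refine (Finset.eventually_all F).2 fun j _ => ?_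
      by_cases hj : j ∈ S
      · filter_upwards [show ∀ᶠ m in (𝒰 : Filter ℕ), j ∈ T m from hj] with m hm
        simp [hm, hj]
      · have : ∀ᶠ m in (𝒰 : Filter ℕ), j ∉ T m := Ultrafilter.eventually_not.2 hj
        filter_upwards [this] with m hm
        simp [hm, hj]
    exact (h1.and h2).exists
  have hhull : ∀ (F : Finset J) (n : ℕ) (r : ℝ≥0∞), 0 < r → ∃ V, MeasurableSet V ∧
      E n \ U ⊆ V ∧ OuterMeasure.mkMetric'.pre κ r V + ∑ j ∈ F, S.indicator w j ≤ c := by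
    intro F n r hr
    let G : Finset J := F ∪ (hdiam r hr).toFinset
    obtain ⟨m, hnm, hm⟩ := hagree G n
    refine ⟨⋃ j ∈ T m \ G, B j, (isOpen_biUnion fun j _ => hB j).measurableSet, ?_, ?_⟩
    · rintro x ⟨hxE, hxU⟩
      obtain ⟨j, hj, hxj⟩ := mem_iUnion₂.1 (hcov m (hE hnm hxE))
      refine mem_iUnion₂.2 ⟨j, ⟨hj, fun hjG => hxU ?_⟩, hxj⟩
      exact mem_iUnion₂.2 ⟨j, (hm j hjG).1 hj, hxj⟩
    · calc OuterMeasure.mkMetric'.pre κ r (⋃ j ∈ T m \ G, B j) + ∑ j ∈ F, S.indicator w j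
          ≤ ∑' j : ↥(T m \ G), w j + ∑ j ∈ G, (T m).indicator w j := by
            gcongr ?_ + ?_
            · refine (measure_biUnion_le _ (to_countable _) _).trans ?_
              refine ENNReal.tsum_le_tsum fun j => ?_
              refine (OuterMeasure.mkMetric'.pre_le ?_).trans (coverContent_le _)
              by_contra hj
              exact j.2.2 (Finset.mem_union_right _ (by simpa using hj))
            · refine (Finset.sum_le_sum_of_subset Finset.subset_union_left).trans
                (Finset.sum_le_sum fun j hj => ?_)
              by_cases h : j ∈ S
              · simp [h, (hm j hj).2 h]
              · simp [h]
        _ = ∑' j : ↥(T m), w j := by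
            rw [tsum_subtype, tsum_subtype, sum_eq_tsum_indicator, ← ENNReal.tsum_add]
            refine tsum_congr fun j => ?_
            by_cases h1 : j ∈ T m <;> by_cases h2 : j ∈ G <;> simp [h1, h2]
        _ ≤ c := (hcost m).le
  let H : Measure X := Measure.mkMetric' κ
  have hκH : ∀ s, κ s ≤ H s := fun s =>
    calc κ s ≤ OuterMeasure.mkMetric' κ s :=
          (le_iSup₂_of_le (f := fun r (_ : r > 0) => OuterMeasure.mkMetric'.pre (X := X) κ r)
            1 one_pos (OuterMeasure.mkMetric'.le_pre.2 fun _ _ => le_rfl) : κ ≤ _) s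
      _ ≤ H s := le_toMeasure_apply _ _ _
  have hH : ∀ (F : Finset J) (n : ℕ), H (E n \ U) + ∑ j ∈ F, S.indicator w j ≤ c := by
    intro F n
    choose V hVm hEV hV using fun k : ℕ =>
      hhull F n (k : ℝ≥0∞)⁻¹ (ENNReal.inv_pos.2 (ENNReal.natCast_ne_top k))
    have hle : H (E n \ U) ≤ OuterMeasure.mkMetric' κ (⋂ k, V k) :=
      (measure_mono (subset_iInter hEV)).trans
        (toMeasure_apply _ _ (MeasurableSet.iInter hVm)).le
    refine (add_le_add_left hle _).trans ?_
    refine le_of_tendsto ((OuterMeasure.mkMetric'.tendsto_pre_nat κ _).add_const _)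
      (Eventually.of_forall fun k => ?_)
    exact (add_le_add_left (measure_mono (iInter_subset V k)) _).trans (hV k)
  have hH' : ∀ n, H (E n \ U) + ∑' j : S, w j ≤ c := by
    intro n
    rw [tsum_subtype, ENNReal.tsum_eq_iSup_sum, ENNReal.add_iSup]
    exact iSup_le fun F => hH F n
  have hHU : H ((⋃ n, E n) \ U) + ∑' j : S, w j ≤ c := by
    have hmono : Monotone fun n => E n \ U := fun m n h => sdiff_subset_sdiff_left (hE h)
    rw [iUnion_sdiff, hmono.measure_iUnion, ENNReal.iSup_add]
    exact iSup_le hH'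
  calc κ (⋃ n, E n) ≤ κ ((⋃ n, E n) \ U ∪ U) := measure_mono (by simp [subset_union_left])
    _ ≤ κ ((⋃ n, E n) \ U) + κ U := measure_union_le _ _
    _ ≤ H ((⋃ n, E n) \ U) + ∑' j : S, w j :=
      add_le_add (hκH _) (coverContent_le_tsum Subset.rfl)
    _ ≤ c := hHU

end CoverContent

/-- A form of Choquet's capacitability theorem. -/
theorem MeasureTheory.AnalyticSet.exists_isCompact_le_outerMeasure {X : Type*} [TopologicalSpace X]
    (κ : OuterMeasure X)
    (hinc : ∀ E : ℕ → Set X, Monotone E → κ (⋃ n, E n) ≤ ⨆ n, κ (E n))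
    (hout : ∀ (K : Set X) (c : ℝ≥0∞), κ K < c → ∃ U, IsOpen U ∧ K ⊆ U ∧ κ U < c)
    {A : Set X} (hA : AnalyticSet A) {c : ℝ≥0∞} (hc : c < κ A) :
    ∃ K ⊆ A, IsCompact K ∧ c ≤ κ K := by
  rw [AnalyticSet] at hA
  obtain rfl | ⟨f, hf, rfl⟩ := hA
  · simp at hc
  have hstep : ∀ (k : ℕ) (D : {D : Set (ℕ → ℕ) // c < κ (f '' D)}),
      ∃ N, c < κ (f '' (D.1 ∩ {y | y k ≤ N})) := by
    rintro k ⟨D, hD⟩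
    refine lt_iSup_iff.1 (hD.trans_le (le_trans (measure_mono ?_) (hinc
      (fun N => f '' (D ∩ {y | y k ≤ N})) fun M N h => image_mono ?_)))
    · rintro _ ⟨y, hy, rfl⟩
      exact mem_iUnion.2 ⟨y k, y, ⟨hy, le_refl (y k)⟩, rfl⟩
    · exact inter_subset_inter_right _ fun y (hy : y k ≤ M) => hy.trans h
  choose N hN using hstep
  let D : ℕ → {D : Set (ℕ → ℕ) // c < κ (f '' D)} := fun k =>
    Nat.rec ⟨univ, by rwa [image_univ]⟩ (fun k D => ⟨D.1 ∩ {y | y k ≤ N k D}, hN k D⟩) k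
  let n : ℕ → ℕ := fun k => N k (D k)
  have hDn : ∀ k, ∀ y ∈ (D k).1, ∀ i < k, y i ≤ n i := by
    intro k
    induction k with
    | zero => intro y _ i hi; omega
    | succ k ih =>
      rintro y ⟨hy, hyk⟩ i hi
      rcases Nat.lt_succ_iff_lt_or_eq.1 hi with h | rfl
      · exact ih y hy i h
      · exact hyk
  have hcpt : IsCompact (Set.pi univ fun i => Iic (n i)) :=
    isCompact_univ_pi fun i => (finite_Iic (n i)).isCompact
  refine ⟨f '' Set.pi univ fun i => Iic (n i), image_subset_range _ _, hcpt.image hf, ?_⟩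
  by_contra! hlt
  obtain ⟨U, hU, hKU, hUc⟩ := hout _ _ hlt
  have hnot : ∀ k, ∃ y ∈ (D k).1, f y ∉ U := by
    intro k
    by_contra! h
    exact ((D k).2.trans_le (measure_mono (image_subset_iff.2 h))).not_gt hUc
  choose y hy hyU using hnot
  obtain ⟨z, hz, φ, hφ, hlim⟩ := hcpt.tendsto_subseq (x := fun k i => min (y k i) (n i))
    fun k i _ => mem_Iic.2 (min_le_right _ _)
  have hylim : Tendsto (y ∘ φ) atTop (𝓝 z) := by
    rw [tendsto_pi_nhds] at hlim ⊢
    refine fun i => (hlim i).congr' ?_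
    filter_upwards [hφ.tendsto_atTop.eventually_gt_atTop i] with k hk
    exact min_eq_left (hDn _ _ (hy (φ k)) i hk)
  obtain ⟨k, hk⟩ := (((hf.tendsto z).comp hylim).eventually
    (hU.mem_nhds (hKU (mem_image_of_mem f hz)))).exists
  exact hyU _ hk

open Classical in
/-- A fractional cover of `K` by balls costs at least as much as the outer measure of `K`, if the
cost of a ball bounds the outer measure of its fivefold enlargement. -/
theorem mul_le_sum_of_le_sum_indicator_ball {X : Type*} [MetricSpace X] (κ : OuterMeasure X)
    {K : Set X} {a : ℝ} (ha : 0 < a) (haK : ENNReal.ofReal a ≤ κ K) (w : X × ℝ → ℝ)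
    (P : Finset (X × ℝ)) :
    ∀ (_ : ∀ p ∈ P, 0 < p.2) (_ : ∀ p ∈ P, 0 ≤ w p)
      (_ : ∀ p ∈ P, κ (ball p.1 (5 * p.2)) ≤ ENNReal.ofReal (w p))
      (c : X × ℝ → ℝ) (_ : ∀ p ∈ P, 0 ≤ c p) (t : ℝ)
      (_ : ∀ x ∈ K, t ≤ ∑ p ∈ P, if x ∈ ball p.1 p.2 then c p else 0),
      t * a ≤ ∑ p ∈ P, c p * w p := by
  induction P using Finset.strongInduction with
  | H P ih =>
  intro hr hw hκ c hc t ht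
  rcases le_or_gt t 0 with ht0 | ht0
  · exact (mul_nonpos_of_nonpos_of_nonneg ht0 ha.le).trans
      (Finset.sum_nonneg fun p hp => mul_nonneg (hc p hp) (hw p hp))
  obtain ⟨u, huP, hdisj, hcov⟩ := Vitali.exists_disjoint_subfamily_covering_enlargement
    (fun p : X × ℝ => ball p.1 p.2) (P : Set (X × ℝ)) (fun p => p.2) 2 one_lt_two
    (fun p hp => (hr p hp).le) (∑ p ∈ P, p.2)
    (fun p hp => Finset.single_le_sum (f := fun p : X × ℝ => p.2) (fun q hq => (hr q hq).le) hp)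
    (fun p hp => nonempty_ball.2 (hr p hp))
  lift u to Finset (X × ℝ) using P.finite_toSet.subset huP
  have huP : u ⊆ P := by exact_mod_cast huP
  have hKu : K ⊆ ⋃ p ∈ u, ball p.1 (5 * p.2) := by
    intro x hx
    obtain ⟨p, hp, hpx⟩ := Finset.exists_ne_zero_of_sum_ne_zero (ht0.trans_le (ht x hx)).ne'
    have hxp : x ∈ ball p.1 p.2 := by
      by_contra h
      exact hpx (if_neg h)
    obtain ⟨q, hq, ⟨y, hyp, hyq⟩, hpq⟩ := hcov p hp
    refine mem_iUnion₂.2 ⟨q, hq, ?_⟩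
    simp only [mem_ball] at hxp hyp hyq ⊢
    have h1 := dist_triangle x p.1 q.1
    have h2 := dist_triangle_left p.1 q.1 y
    linarith
  have hau : a ≤ ∑ p ∈ u, w p := by
    rw [← ENNReal.ofReal_le_ofReal_iff (Finset.sum_nonneg fun p hp => hw p (huP hp)),
      ENNReal.ofReal_sum_of_nonneg fun p hp => hw p (huP hp)]
    exact haK.trans ((measure_mono hKu).trans ((measure_biUnion_finset_le _ _).trans
      (Finset.sum_le_sum fun p hp => hκ p (huP hp))))
  have hune : u.Nonempty := by
    rw [Finset.nonempty_iff_ne_empty]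
    rintro rfl
    simp at hau
    linarith
  obtain ⟨p₀, hp₀, hmin⟩ := u.exists_min_image c hune
  let c' : X × ℝ → ℝ := fun p => c p - if p ∈ u then c p₀ else 0
  have hc'0 : c' p₀ = 0 := by simp [c', hp₀]
  have hsplit : ∀ g : X × ℝ → ℝ, ∑ p ∈ P, c' p * g p =
      ∑ p ∈ P, c p * g p - c p₀ * ∑ p ∈ u, g p := by
    intro g
    simp only [c', sub_mul, Finset.sum_sub_distrib, ite_mul, zero_mul, ← Finset.sum_filter,
      Finset.mul_sum]
    congr 2
    ext p
    simpa using @huP p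
  have herase : ∀ g : X × ℝ → ℝ, ∑ p ∈ P.erase p₀, c' p * g p = ∑ p ∈ P, c' p * g p :=
    fun g => Finset.sum_erase _ (by simp [hc'0])
  have key := ih (P.erase p₀) (Finset.erase_ssubset (huP hp₀))
    (fun p hp => hr p (Finset.mem_of_mem_erase hp)) (fun p hp => hw p (Finset.mem_of_mem_erase hp))
    (fun p hp => hκ p (Finset.mem_of_mem_erase hp)) c' ?_ (t - c p₀) ?_
  · rw [herase, hsplit] at key
    nlinarith [mul_le_mul_of_nonneg_left hau (hc p₀ (huP hp₀))]
  · intro p hp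
    by_cases hpu : p ∈ u
    · simpa [c', hpu] using hmin p hpu
    · simpa [c', hpu] using hc p (Finset.mem_of_mem_erase hp)
  · intro x hx
    have h1 : ∀ (Q : Finset (X × ℝ)) (d : X × ℝ → ℝ),
        (∑ p ∈ Q, if x ∈ ball p.1 p.2 then d p else 0) =
        ∑ p ∈ Q, d p * if x ∈ ball p.1 p.2 then 1 else 0 := fun Q d => by simp
    have h2 : (∑ p ∈ u, if x ∈ ball p.1 p.2 then (1 : ℝ) else 0) ≤ 1 := by
      rw [Finset.sum_boole]
      norm_cast
      refine Finset.card_le_one.2 fun p hp q hq => ?_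
      rw [Finset.mem_filter] at hp hq
      by_contra hne
      exact (disjoint_left.1 (hdisj hp.1 hq.1 hne)) hp.2 hq.2
    rw [h1, herase, hsplit, ← h1]
    nlinarith [ht x hx, mul_le_mul_of_nonneg_left h2 (hc p₀ (huP hp₀))]

open Classical in
/-- By linear programming duality, a set of positive content carries a probability measure
satisfying finitely many prescribed ball estimates. -/
theorem exists_isProbabilityMeasure_forall_finset_ball_le {X : Type*} [MetricSpace X]
    [MeasurableSpace X] [BorelSpace X] (κ : OuterMeasure X) {K : Set X}
    {a : ℝ} (ha : 0 < a) (haK : ENNReal.ofReal a ≤ κ K) (w : X × ℝ → ℝ) (P : Finset (X × ℝ))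
    (hr : ∀ p ∈ P, 0 < p.2) (hw : ∀ p ∈ P, 0 ≤ w p)
    (hκ : ∀ p ∈ P, κ (ball p.1 (5 * p.2)) ≤ ENNReal.ofReal (w p)) :
    ∃ μ : Measure X, IsProbabilityMeasure μ ∧ μ K = 1 ∧
      ∀ p ∈ P, μ (ball p.1 p.2) ≤ ENNReal.ofReal (w p / a) := by
  let v : X → P → ℝ := fun x p => if x ∈ ball p.1.1 p.1.2 then 1 else 0
  let Q : Set (P → ℝ) := Iic fun p => w p / a
  have hfin : (v '' K).Finite := by
    refine (Set.Finite.pi' (t := fun _ : P => ({0, 1} : Set ℝ))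
      fun _ => by simp).subset ?_
    rintro _ ⟨x, -, rfl⟩ p
    simp only [v]
    split_ifs <;> simp
  have hinter : ∃ z ∈ convexHull ℝ (v '' K), z ∈ Q := by
    by_contra! hdisj
    obtain ⟨f, b, b', hfb, hbb', hfb'⟩ := geometric_hahn_banach_closed_compact
      (convex_Iic _ : Convex ℝ Q) isClosed_Iic (convex_convexHull ℝ (v '' K))
      (hfin.isCompact_convexHull ℝ) (disjoint_right.2 hdisj : Disjoint Q _)
    let l : P → ℝ := fun p => f (Pi.single p 1)
    have hf : ∀ y, f y = ∑ p, y p * l p := by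
      intro y
      conv_lhs => rw [pi_eq_sum_univ' y]
      simp [l]
    have hl : ∀ p, 0 ≤ l p := by
      intro p
      by_contra! hneg
      let q₀ : P → ℝ := fun p => w p / a
      have hq : q₀ - ((b - f q₀) / (-l p)) • Pi.single p 1 ∈ Q := by
        have h0 : f q₀ < b := hfb _ (mem_Iic.2 le_rfl)
        refine mem_Iic.2 (sub_le_self _ (smul_nonneg
          (div_nonneg (by linarith) (by linarith)) ?_))
        exact Pi.single_nonneg.2 zero_le_one
      have h1 := hfb _ hq
      rw [map_sub, map_smul, smul_eq_mul] at h1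
      change f q₀ - (b - f q₀) / (-l p) * l p < b at h1
      have h2 : (b - f q₀) / (-l p) * l p = -(b - f q₀) := by
        field_simp [hneg.ne]
      linarith
    let c : X × ℝ → ℝ := fun p => if h : p ∈ P then l ⟨p, h⟩ else 0
    have hsum : ∀ g : X × ℝ → ℝ, ∑ p ∈ P, g p * c p = ∑ p : P, g p * l p := by
      intro g
      rw [← Finset.sum_coe_sort]
      exact Finset.sum_congr rfl fun p _ => by simp [c]
    have hcost := mul_le_sum_of_le_sum_indicator_ball κ ha haK w P hr hw hκ c
      (fun p hp => by simpa [c, hp] using hl ⟨p, hp⟩) b' (fun x hx => by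
        have h1 := (hfb' _ (subset_convexHull ℝ _ (mem_image_of_mem v hx))).le
        rw [hf, ← hsum fun p => if x ∈ ball p.1 p.2 then 1 else 0] at h1
        simpa using h1)
    have h2 := hfb _ (mem_Iic.2 le_rfl)
    rw [hf, ← hsum fun p => w p / a] at h2
    have h3 : ∑ p ∈ P, w p / a * c p = (∑ p ∈ P, c p * w p) / a := by
      rw [Finset.sum_div]
      exact Finset.sum_congr rfl fun p _ => by ring
    rw [h3, div_lt_iff₀ ha] at h2
    nlinarith
  obtain ⟨z, hz, hzQ⟩ := hinter
  let R : Set (P → ℝ) := {y | ∃ μ : Measure X, IsProbabilityMeasure μ ∧ μ K = 1 ∧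
    ∀ p : P, μ.real (ball p.1.1 p.1.2) = y p}
  have hR : convexHull ℝ (v '' K) ⊆ R := by
    refine convexHull_min ?_ ?_
    · rintro _ ⟨x, hx, rfl⟩
      refine ⟨Measure.dirac x, inferInstance, by simp [hx], fun p => ?_⟩
      rw [measureReal_def, Measure.dirac_apply' _ measurableSet_ball]
      by_cases h : x ∈ ball p.1.1 p.1.2
      · simp only [v, h, indicator_of_mem, if_true]; simp
      · simp only [v, h, not_false_eq_true, indicator_of_notMem, if_false]; simp
    · rintro y ⟨μ, hμ, hμK, hμy⟩ y' ⟨ν, hν, hνK, hνy⟩ α β hα hβ hαβ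
      have hone : ENNReal.ofReal α + ENNReal.ofReal β = 1 := by
        rw [← ENNReal.ofReal_add hα hβ, hαβ, ENNReal.ofReal_one]
      refine ⟨ENNReal.ofReal α • μ + ENNReal.ofReal β • ν, ⟨?_⟩, ?_, fun p => ?_⟩
      · simp [hone]
      · simp [hμK, hνK, hone]
      · have hα' : (ENNReal.ofReal α • μ) (ball p.1.1 p.1.2) ≠ ∞ :=
          ENNReal.mul_ne_top ENNReal.ofReal_ne_top (measure_ne_top _ _)
        have hβ' : (ENNReal.ofReal β • ν) (ball p.1.1 p.1.2) ≠ ∞ :=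
          ENNReal.mul_ne_top ENNReal.ofReal_ne_top (measure_ne_top _ _)
        rw [measureReal_add_apply hα' hβ', measureReal_ennreal_smul_apply,
          measureReal_ennreal_smul_apply, hμy, hνy, ENNReal.toReal_ofReal hα,
          ENNReal.toReal_ofReal hβ]
        rfl
  obtain ⟨μ, hμ, hμK, hμz⟩ := hR hz
  refine ⟨μ, hμ, hμK, fun p hp => ?_⟩
  rw [← ofReal_measureReal, hμz ⟨p, hp⟩]
  exact ENNReal.ofReal_le_ofReal (hzQ ⟨p, hp⟩)

/-- Frostman's lemma for a closed set of positive content. -/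
theorem exists_isProbabilityMeasure_forall_ball_le {X : Type*} [MetricSpace X] [CompactSpace X]
    [MeasurableSpace X] [BorelSpace X] (κ : OuterMeasure X) {K : Set X} (hK : IsClosed K)
    {a : ℝ} (ha : 0 < a) (haK : ENNReal.ofReal a ≤ κ K) (w : X × ℝ → ℝ)
    (hw : ∀ p, 0 < p.2 → 0 ≤ w p)
    (hκ : ∀ p, 0 < p.2 → κ (ball p.1 (5 * p.2)) ≤ ENNReal.ofReal (w p)) :
    ∃ μ : Measure X, IsProbabilityMeasure μ ∧ μ K = 1 ∧
      ∀ p, 0 < p.2 → μ (ball p.1 p.2) ≤ ENNReal.ofReal (w p / a) := by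
  classical
  choose μ hμ hμK hμball using fun P : Finset (X × ℝ) =>
    exists_isProbabilityMeasure_forall_finset_ball_le κ ha haK w
      (P.filter fun p => 0 < p.2) (fun p hp => (Finset.mem_filter.1 hp).2)
      (fun p hp => hw p (Finset.mem_filter.1 hp).2) (fun p hp => hκ p (Finset.mem_filter.1 hp).2)
  let ν : Finset (X × ℝ) → ProbabilityMeasure X := fun P => ⟨μ P, hμ P⟩
  let 𝒰 : Ultrafilter (Finset (X × ℝ)) := Ultrafilter.of atTop
  obtain ⟨ρ, -, hρ⟩ := isCompact_univ.ultrafilter_le_nhds (𝒰.map ν) (by simp)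
  have hlim : Tendsto ν 𝒰 (𝓝 ρ) := hρ
  refine ⟨ρ, inferInstance, le_antisymm prob_le_one ?_, fun p hp => ?_⟩
  · refine le_trans ?_ (ProbabilityMeasure.limsup_measure_closed_le_of_tendsto hlim hK)
    simp [ν, hμK]
  · refine (ProbabilityMeasure.le_liminf_measure_open_of_tendsto hlim isOpen_ball).trans ?_
    refine liminf_le_of_frequently_le' (Eventually.frequently ?_)
    have hmem : ∀ᶠ P in (𝒰 : Filter (Finset (X × ℝ))), p ∈ P :=
      Ultrafilter.of_le atTop ((eventually_ge_atTop {p}).mono fun P hP => by simpa using hP)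
    filter_upwards [hmem] with P hP
    exact hμball P p (Finset.mem_filter.2 ⟨hP, hp⟩)

/-- The index type of the balls `ball x (2 * 2⁻ᵏ)` with `x` in the finite net `N k`. -/
abbrev NetIndex {X : Type*} (N : ℕ → Finset X) : Type _ := Σ k, N k

section Net

variable {X : Type*} [MetricSpace X] (N : ℕ → Finset X)

/-- The ball of the net `N k` with the given index. -/
def netBall (j : NetIndex N) : Set X := ball (j.2 : X) (2 * (1 / 2) ^ j.1)

/-- The content of a sequence of nets, in which a ball of level `k` has weight `2⁻ᵏˢ`. -/
noncomputable def netContent (s : ℝ) : OuterMeasure X :=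
  coverContent (netBall N) fun j => ENNReal.ofReal (((1 / 2 : ℝ) ^ j.1) ^ s)

variable {N}

theorem ediam_netBall_le (j : NetIndex N) :
    ediam (netBall N j) ≤ ENNReal.ofReal (4 * (1 / 2) ^ j.1) := by
  refine ediam_le_of_forall_dist_le fun x hx y hy => ?_
  simp only [netBall, mem_ball] at hx hy
  linarith [dist_triangle_right x y (j.2 : X)]

theorem finite_setOf_lt_ediam_netBall {r : ℝ≥0∞} (hr : 0 < r) :
    {j | r < ediam (netBall N j)}.Finite := by
  have hlim : Tendsto (fun k : ℕ => ENNReal.ofReal (4 * (1 / 2) ^ k)) atTop (𝓝 0) := by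
    rw [← ENNReal.ofReal_zero, ← mul_zero (4 : ℝ)]
    exact ENNReal.tendsto_ofReal ((_root_.tendsto_pow_atTop_nhds_zero_of_lt_one
      (by norm_num) (by norm_num)).const_mul 4)
  obtain ⟨n, hn⟩ := eventually_atTop.1 (hlim.eventually (ge_mem_nhds hr))
  refine ((finite_Iio n).biUnion fun k _ =>
    finite_range (fun x : N k => (⟨k, x⟩ : NetIndex N))).subset ?_
  rintro ⟨k, x⟩ hj
  refine mem_iUnion₂.2 ⟨k, ?_, x, rfl⟩
  by_contra hk
  exact (hj.trans_le (ediam_netBall_le _)).not_ge (hn k (not_lt.1 hk))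

theorem netContent_ball_le (hN : ∀ k, ∀ x : X, ∃ y ∈ N k, dist x y < (1 / 2) ^ k)
    {s : ℝ} (hs : 0 < s) (x : X) {r : ℝ} (hr : 0 < r) :
    netContent N s (ball x r) ≤ ENNReal.ofReal ((2 ^ s + (N 0).card) * r ^ s) := by
  have hrs : 0 < r ^ s := Real.rpow_pos_of_pos hr s
  rcases le_or_gt r 1 with h1 | h1
  · obtain ⟨k, hk, hk'⟩ := exists_nat_pow_near_of_lt_one hr h1 (by norm_num : (0 : ℝ) < 1 / 2)
      (by norm_num)
    obtain ⟨y, hy, hxy⟩ := hN k x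
    refine (measure_mono (t := netBall N ⟨k, y, hy⟩) ?_).trans
      ((coverContent_le _).trans (ENNReal.ofReal_le_ofReal ?_))
    · refine ball_subset_ball' ?_
      dsimp only
      linarith
    · calc (((1 / 2 : ℝ) ^ k) ^ s) ≤ (2 * r) ^ s := by
            refine Real.rpow_le_rpow (by positivity) ?_ hs.le
            rw [pow_succ] at hk
            linarith
        _ = 2 ^ s * r ^ s := Real.mul_rpow (by norm_num) hr.le
        _ ≤ (2 ^ s + (N 0).card) * r ^ s := by
            gcongr
            simp
  · have hcover : ball x r ⊆ ⋃ j ∈ range (fun x : N 0 => (⟨0, x⟩ : NetIndex N)), netBall N j := by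
      intro z _
      obtain ⟨y, hy, hzy⟩ := hN 0 z
      refine mem_iUnion₂.2 ⟨⟨0, y, hy⟩, mem_range_self _, ?_⟩
      simp only [netBall, mem_ball]
      norm_num at hzy ⊢
      linarith
    refine (coverContent_le_tsum hcover).trans ?_
    rw [tsum_range (g := (fun x : N 0 => (⟨0, x⟩ : NetIndex N)))
      (fun j => ENNReal.ofReal (((1 / 2 : ℝ) ^ j.1) ^ s)) (sigma_mk_injective (β := fun k => N k))]
    simp only [pow_zero, Real.one_rpow, ENNReal.ofReal_one, tsum_fintype, Finset.sum_const,
      Finset.card_univ, Fintype.card_coe, nsmul_eq_mul, mul_one]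
    rw [← ENNReal.ofReal_natCast]
    refine ENNReal.ofReal_le_ofReal ?_
    have h2 : (0 : ℝ) < 2 ^ s := by positivity
    have h3 : 1 ≤ r ^ s := Real.one_le_rpow h1.le hs.le
    have h4 : (0 : ℝ) ≤ (N 0).card := by positivity
    nlinarith

theorem hausdorffMeasure_eq_zero_of_netContent_eq_zero [MeasurableSpace X] [BorelSpace X]
    {s : ℝ} (hs : 0 < s) {A : Set X} (hA : netContent N s A = 0) : μH[s] A = 0 := by
  have hpow : Tendsto (fun n : ℕ => (1 / 2 : ℝ) ^ n) atTop (𝓝 0) :=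
    _root_.tendsto_pow_atTop_nhds_zero_of_lt_one (by norm_num) (by norm_num)
  choose T hcov hcost using fun n : ℕ => exists_cover_of_coverContent_lt
    (show netContent N s A < ENNReal.ofReal (((1 / 2 : ℝ) ^ n) ^ s) by
      rw [hA, ENNReal.ofReal_pos]
      positivity)
  have hlevel : ∀ n, ∀ j : T n, n ≤ j.1.1 := by
    intro n j
    by_contra! hlt
    have h1 := (ENNReal.le_tsum j).trans_lt (hcost n)
    refine h1.not_ge (ENNReal.ofReal_le_ofReal (Real.rpow_le_rpow (by positivity) ?_ hs.le))
    exact pow_le_pow_of_le_one (by norm_num) (by norm_num) hlt.le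
  have hle := Measure.hausdorffMeasure_le_liminf_tsum s A (l := atTop)
    (fun n => ENNReal.ofReal (4 * (1 / 2) ^ n))
    (by simpa using ENNReal.tendsto_ofReal (hpow.const_mul 4))
    (fun n (j : T n) => netBall N j.1)
    (Eventually.of_forall fun n j => (ediam_netBall_le _).trans (ENNReal.ofReal_le_ofReal
      (mul_le_mul_of_nonneg_left
        (pow_le_pow_of_le_one (by norm_num) (by norm_num) (hlevel n j)) (by norm_num))))
    (Eventually.of_forall fun n => by simpa only [biUnion_eq_iUnion] using hcov n)
  have hlim : Tendsto (fun n : ℕ => ENNReal.ofReal (4 ^ s * ((1 / 2 : ℝ) ^ n) ^ s)) atTop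
      (𝓝 0) := by
    have := ((hpow.rpow_const (Or.inr hs.le) : Tendsto _ _ (𝓝 ((0 : ℝ) ^ s)))).const_mul
      ((4 : ℝ) ^ s)
    rw [Real.zero_rpow hs.ne', mul_zero] at this
    simpa using ENNReal.tendsto_ofReal this
  refine le_antisymm (hle.trans ?_) zero_le
  rw [← hlim.liminf_eq]
  refine liminf_le_liminf (Eventually.of_forall fun n => ?_)
  calc ∑' j : T n, ediam (netBall N j.1) ^ s
      ≤ ∑' j : T n, ENNReal.ofReal (4 ^ s) * ENNReal.ofReal (((1 / 2 : ℝ) ^ j.1.1) ^ s) := by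
        refine ENNReal.tsum_le_tsum fun j => ?_
        refine (ENNReal.rpow_le_rpow (ediam_netBall_le _) hs.le).trans_eq ?_
        rw [ENNReal.ofReal_rpow_of_nonneg (by positivity) hs.le,
          Real.mul_rpow (by norm_num) (by positivity), ENNReal.ofReal_mul (by positivity)]
    _ ≤ ENNReal.ofReal (4 ^ s * ((1 / 2 : ℝ) ^ n) ^ s) := by
        rw [ENNReal.tsum_mul_left, ENNReal.ofReal_mul (by positivity)]
        gcongr
        exact (hcost n).le

end Net

/-- **Frostman's lemma on compact metric spaces.** If `A` is a Borel subset of a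
compact metric space with positive `s`-dimensional Hausdorff measure, `s > 0`, then there are a
Borel probability measure `μ` with `μ(A) = 1` and a constant `c > 0` with
`μ(B(x,r)) ≤ c r^s` for all `x` and all `r > 0`. -/
theorem frostman_lemma_compact_metric
    {X : Type*} [MetricSpace X] [CompactSpace X] [MeasurableSpace X] [BorelSpace X]
    (s : ℝ) (hs : 0 < s) (A : Set X) (hA : MeasurableSet A)
    (hpos : 0 < μH[s] A) :
    ∃ μ : Measure X, IsProbabilityMeasure μ ∧ μ A = 1 ∧
      ∃ c : ℝ, 0 < c ∧ ∀ (x : X) (r : ℝ), 0 < r →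
        μ (Metric.ball x r) ≤ ENNReal.ofReal (c * r ^ s) := by
  classical
  have hnet : ∀ k : ℕ, ∃ F : Finset X, ∀ x : X, ∃ y ∈ F, dist x y < (1 / 2) ^ k := by
    intro k
    obtain ⟨t, -, ht, hcov⟩ := (isCompact_univ (X := X)).finite_cover_balls
      (e := (1 / 2) ^ k) (by positivity)
    exact ⟨ht.toFinset, fun x => by simpa using hcov (mem_univ x)⟩
  choose N hN using hnet
  set κ := netContent N s
  have hopen : ∀ j, IsOpen (netBall N j) := fun j => isOpen_ball
  have hκA : 0 < κ A := by
    rw [pos_iff_ne_zero]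
    exact fun h => hpos.ne' (hausdorffMeasure_eq_zero_of_netContent_eq_zero hs h)
  obtain ⟨a, ha, haA⟩ := ENNReal.lt_iff_exists_nnreal_btwn.1 hκA
  obtain ⟨K, hKA, hK, haK⟩ := hA.analyticSet.exists_isCompact_le_outerMeasure κ
    (fun E hE => coverContent_iUnion_le_iSup hopen (fun r => finite_setOf_lt_ediam_netBall) E hE)
    (fun E c hE => exists_isOpen_coverContent_lt hopen hE) haA
  have ha : (0 : ℝ) < a := by exact_mod_cast ha
  obtain ⟨μ, hμ, hμK, hμball⟩ := exists_isProbabilityMeasure_forall_ball_le κ hK.isClosed ha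
    (by rwa [ENNReal.ofReal_coe_nnreal]) (fun p => (2 ^ s + (N 0).card) * (5 * p.2) ^ s)
    (fun p hp => by positivity)
    (fun p hp => netContent_ball_le hN hs p.1 (by positivity))
  refine ⟨μ, hμ, le_antisymm prob_le_one (hμK ▸ measure_mono hKA),
    (2 ^ s + (N 0).card) * 5 ^ s / a, by positivity, fun x r hr => ?_⟩
  refine (hμball (x, r) hr).trans_eq (congrArg ENNReal.ofReal ?_)
  dsimp only
  rw [Real.mul_rpow (by norm_num) hr.le]
  ring
end

section
/- Fix η > 1. For each integer j ≥ 3 let h_j : [1,2] → ℝ be a measurable function with 1 ≤ h_j(u) ≤ j/(1+ln j) for all u ∈ [1,2], and define f_j : (0,1] → ℝ by f_j(r) = j^η/(1+ln j) for r ∈ (0, 1/j^η]; f_j(r) = 1/( r·(1 − ln r) ) for r ∈ (1/j^η, 1/j]; f_j(r) = h_j(j r) for r ∈ (1/j, 2/j]; and f_j(r) = 1 for r ∈ (2/j, 1]. Then lim_{j→∞} ∫_0^1 f_j(r) dr = 1 + ln η. -/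
open MeasureTheory Filter

lemma hasDerivAt_neg_log_one_sub_log {r : ℝ} (h0 : 0 < r) (h1 : r ≤ 1) :
    HasDerivAt (fun x => -Real.log (1 - Real.log x)) (1 / (r * (1 - Real.log r))) r := by
  have hlog : 0 < 1 - Real.log r := by linarith [Real.log_nonpos h0.le h1]
  refine (((Real.hasDerivAt_log h0.ne').const_sub 1).log hlog.ne').neg.congr_deriv ?_
  field_simp

lemma intervalIntegrable_one_div_mul_one_sub_log {a b : ℝ} (ha : 0 < a) (hab : a ≤ b)
    (hb : b ≤ 1) :
    IntervalIntegrable (fun r => 1 / (r * (1 - Real.log r))) volume a b := by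
  refine ContinuousOn.intervalIntegrable fun r hr => ContinuousAt.continuousWithinAt ?_
  rw [Set.uIcc_of_le hab] at hr
  have h0 : 0 < r := ha.trans_le hr.1
  have hlog : 0 < 1 - Real.log r := by linarith [Real.log_nonpos h0.le (hr.2.trans hb)]
  exact continuousAt_const.div
    (continuousAt_id.mul (continuousAt_const.sub (Real.continuousAt_log h0.ne')))
    (mul_pos h0 hlog).ne'

lemma integral_one_div_mul_one_sub_log {a b : ℝ} (ha : 0 < a) (hab : a ≤ b) (hb : b ≤ 1) :
    ∫ r in a..b, 1 / (r * (1 - Real.log r)) =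
      Real.log (1 - Real.log a) - Real.log (1 - Real.log b) := by
  rw [intervalIntegral.integral_eq_sub_of_hasDerivAt
    (f := fun x => -Real.log (1 - Real.log x)) (fun r hr => ?_)
    (intervalIntegrable_one_div_mul_one_sub_log ha hab hb)]
  · ring
  · rw [Set.uIcc_of_le hab] at hr
    exact hasDerivAt_neg_log_one_sub_log (ha.trans_le hr.1) (hr.2.trans hb)

/-- The integral of a function on `(0, 1]` that is constant near `0`, equal to
`1 / (r * (1 - log r))` on `(a, b]`, bounded on `(b, c]` and equal to `1` on `(c, 1]`. -/
lemma abs_integral_sub_le_of_piecewise {a b c K M : ℝ} {g F : ℝ → ℝ} (hg : Measurable g)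
    (ha : 0 < a) (hab : a ≤ b) (hbc : b ≤ c) (hc : c ≤ 1)
    (hK : ∀ r ∈ Set.Ioc 0 a, F r = K)
    (hlog : ∀ r ∈ Set.Ioc a b, F r = 1 / (r * (1 - Real.log r)))
    (hFg : ∀ r ∈ Set.Ioc b c, F r = g r) (hgM : ∀ r ∈ Set.Ioc b c, ‖g r‖ ≤ M)
    (hone : ∀ r ∈ Set.Ioc c 1, F r = 1) :
    |(∫ r in Set.Ioc 0 1, F r) - (a * K +
      (Real.log (1 - Real.log a) - Real.log (1 - Real.log b)) + (1 - c))| ≤ M * (c - b) := by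
  have e1 : Set.EqOn F (fun _ => K) (Set.uIoc 0 a) := by
    rwa [Set.uIoc_of_le ha.le]
  have e2 : Set.EqOn F (fun r => 1 / (r * (1 - Real.log r))) (Set.uIoc a b) := by
    rwa [Set.uIoc_of_le hab]
  have e3 : Set.EqOn F g (Set.uIoc b c) := by
    rwa [Set.uIoc_of_le hbc]
  have e4 : Set.EqOn F (fun _ => (1 : ℝ)) (Set.uIoc c 1) := by
    rwa [Set.uIoc_of_le hc]
  have i1 : IntervalIntegrable F volume 0 a :=
    (intervalIntegrable_congr e1).2 intervalIntegrable_const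
  have i2 : IntervalIntegrable F volume a b := (intervalIntegrable_congr e2).2
    (intervalIntegrable_one_div_mul_one_sub_log ha hab (hbc.trans hc))
  have i3 : IntervalIntegrable F volume b c := by
    refine (intervalIntegrable_congr e3).2 ?_
    rw [intervalIntegrable_iff_integrableOn_Ioc_of_le hbc]
    exact Measure.integrableOn_of_bounded (M := M) measure_Ioc_lt_top.ne
      hg.aestronglyMeasurable ((ae_restrict_iff' measurableSet_Ioc).2 (ae_of_all _ hgM))
  have i4 : IntervalIntegrable F volume c 1 :=
    (intervalIntegrable_congr e4).2 intervalIntegrable_const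
  have h1 : ∫ r in 0..a, F r = a * K := by
    rw [intervalIntegral.integral_congr_ae (ae_of_all _ fun _ hx => e1 hx)]; simp
  have h2 : ∫ r in a..b, F r = Real.log (1 - Real.log a) - Real.log (1 - Real.log b) := by
    rw [intervalIntegral.integral_congr_ae (ae_of_all _ fun _ hx => e2 hx),
      integral_one_div_mul_one_sub_log ha hab (hbc.trans hc)]
  have h4 : ∫ r in c..1, F r = 1 - c := by
    rw [intervalIntegral.integral_congr_ae (ae_of_all _ fun _ hx => e4 hx)]; simp
  have h3 : |∫ r in b..c, F r| ≤ M * (c - b) := by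
    have := intervalIntegral.norm_integral_le_of_norm_le_const (a := b) (b := c) (f := F)
      (C := M) fun r hr => by
        rw [e3 hr]
        rw [Set.uIoc_of_le hbc] at hr
        exact hgM r hr
    rwa [abs_of_nonneg (sub_nonneg.2 hbc)] at this
  rw [← intervalIntegral.integral_of_le zero_le_one,
    ← intervalIntegral.integral_add_adjacent_intervals ((i1.trans i2).trans i3) i4,
    ← intervalIntegral.integral_add_adjacent_intervals (i1.trans i2) i3,
    ← intervalIntegral.integral_add_adjacent_intervals i1 i2, h1, h2, h4]
  convert h3 using 2
  ring

lemma tendsto_log_one_add_mul_sub_log_one_add {η : ℝ} (hη : 0 < η) :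
    Tendsto (fun x : ℝ => Real.log (1 + η * x) - Real.log (1 + x)) atTop
      (nhds (Real.log η)) := by
  have h0 : Tendsto (fun x : ℝ => (1 + x)⁻¹) atTop (nhds 0) :=
    tendsto_inv_atTop_zero.comp (tendsto_atTop_add_const_left _ _ tendsto_id)
  have h1 : Tendsto (fun x : ℝ => η + (1 - η) * (1 + x)⁻¹) atTop (nhds η) := by
    simpa using (h0.const_mul (1 - η)).const_add η
  refine (h1.log hη.ne').congr' ?_
  filter_upwards [eventually_ge_atTop 0] with x hx
  have hx1 : 0 < 1 + x := by positivity
  have hx2 : 0 < 1 + η * x := by positivity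
  rw [← Real.log_div hx2.ne' hx1.ne']
  congr 1
  field_simp
  ring

/-- For the radial conformal factors `f_j` on `(0,1]` (with `η > 1` and
`1 ≤ h_j ≤ j/(1+ln j)` on `[1,2]`), the integrals `∫_0^1 f_j(r) dr` converge to `1 + ln η`. -/
theorem radial_conformal_factor_integral_limit
    (η : ℝ) (hη : 1 < η)
    (h : ℕ → ℝ → ℝ) (hmeas : ∀ j, Measurable (h j))
    (hbound : ∀ j : ℕ, 3 ≤ j → ∀ u ∈ Set.Icc (1:ℝ) 2,
      1 ≤ h j u ∧ h j u ≤ (j : ℝ) / (1 + Real.log j))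
    (f : ℕ → ℝ → ℝ)
    (hf : ∀ j : ℕ, 3 ≤ j → ∀ r ∈ Set.Ioc (0:ℝ) 1,
      f j r =
        if r ≤ 1 / (j : ℝ) ^ η then (j : ℝ) ^ η / (1 + Real.log j)
        else if r ≤ 1 / (j : ℝ) then 1 / (r * (1 - Real.log r))
        else if r ≤ 2 / (j : ℝ) then h j ((j : ℝ) * r)
        else 1) :
    Tendsto (fun j : ℕ => ∫ r in Set.Ioc (0:ℝ) 1, f j r)
      atTop (nhds (1 + Real.log η)) := by
  have hL : Tendsto (fun j : ℕ => Real.log j) atTop atTop :=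
    Real.tendsto_log_atTop.comp tendsto_natCast_atTop_atTop
  have h0 : Tendsto (fun j : ℕ => (1 + Real.log j)⁻¹) atTop (nhds 0) :=
    tendsto_inv_atTop_zero.comp (tendsto_atTop_add_const_left _ _ hL)
  have hmain : Tendsto (fun j : ℕ => (1 + Real.log j)⁻¹ +
      (Real.log (1 + η * Real.log j) - Real.log (1 + Real.log j)) + (1 - 2 / (j : ℝ))) atTop
      (nhds (1 + Real.log η)) := by
    convert (h0.add ((tendsto_log_one_add_mul_sub_log_one_add (by linarith)).comp hL)).add
      ((tendsto_const_div_atTop_nhds_zero_nat (2 : ℝ)).const_sub 1) using 2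
    · rfl
    · ring
  refine tendsto_of_tendsto_of_dist hmain (squeeze_zero' (.of_forall fun _ => dist_nonneg) ?_ h0)
  filter_upwards [eventually_ge_atTop 3] with j hj
  have hj3 : (3 : ℝ) ≤ j := by exact_mod_cast hj
  have hj0 : (0 : ℝ) < j := by linarith
  have hlog : 0 < 1 + Real.log j := by linarith [Real.log_nonneg (by linarith : (1 : ℝ) ≤ j)]
  have hpow : (0 : ℝ) < (j : ℝ) ^ η := by positivity
  have hab : 1 / (j : ℝ) ^ η ≤ 1 / j :=
    one_div_le_one_div_of_le hj0 (Real.self_le_rpow_of_one_le (by linarith) hη.le)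
  have hbc : 1 / (j : ℝ) ≤ 2 / j := by gcongr; norm_num
  have hc : 2 / (j : ℝ) ≤ 1 := by rw [div_le_one hj0]; linarith
  have ha : 0 < 1 / (j : ℝ) ^ η := by positivity
  have key := abs_integral_sub_le_of_piecewise (F := f j) (g := fun r => h j (j * r))
    (M := j / (1 + Real.log j)) (K := (j : ℝ) ^ η / (1 + Real.log j))
    ((hmeas j).comp (measurable_const_mul _)) ha hab hbc hc
    (fun r hr => by
      rw [hf j hj r ⟨hr.1, by linarith [hr.2]⟩, if_pos hr.2])
    (fun r hr => by
      rw [hf j hj r ⟨by linarith [hr.1], by linarith [hr.2]⟩, if_neg hr.1.not_ge, if_pos hr.2])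
    (fun r hr => by
      rw [hf j hj r ⟨by linarith [hr.1], by linarith [hr.2]⟩,
        if_neg (by linarith [hr.1]), if_neg hr.1.not_ge, if_pos hr.2])
    (fun r hr => by
      have hu := hbound j hj (j * r)
        ⟨((div_lt_iff₀' hj0).1 hr.1).le, (le_div_iff₀' hj0).1 hr.2⟩
      rw [Real.norm_of_nonneg (by linarith [hu.1])]
      exact hu.2)
    (fun r hr => by
      rw [hf j hj r ⟨by linarith [hr.1], hr.2⟩,
        if_neg (by linarith [hr.1]), if_neg (by linarith [hr.1]), if_neg hr.1.not_ge])
  rw [dist_comm, Real.dist_eq]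
  convert key using 2
  · congr 3
    · field_simp
    · rw [one_div, one_div, Real.log_inv, Real.log_inv, Real.log_rpow hj0]
      simp only [sub_neg_eq_add]
  · field_simp
    ring
end
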